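/- The Hilbert series of C[x_1,...,x_n]/⟨QInv_{n,m}^+⟩ satisfies F_{n,m}(t) = ((1-t^m)/(1-t))·F_n(t^m), where F_n(t) = Σ_{k=0}^{n-1} ((n-k)/(n+k))·binom(n+k,k)·t^k; equivalently, the generating polynomial Σ t^{|mη+α|} over Dyck vectors η ∈ N^n and α ∈ {0,...,m-1}^n equals (1+t+...+t^{m-1})^n · F_n(t^m). -/

import Mathlib

open MvPolynomial Polynomial

def qcomp {n : ℕ} (ν : Fin n →₀ ℕ) : List ℕ :=
  (List.ofFn fun i => ν i).filter (· ≠ 0)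

def IsQuasiSym {n : ℕ} (P : MvPolynomial (Fin n) ℂ) : Prop :=
  ∀ ν μ : Fin n →₀ ℕ, qcomp ν = qcomp μ → P.coeff ν = P.coeff μ

/-- Quasi-invariants of `G_{n,m}` with zero constant term. -/
def QInvPlus (n m : ℕ) : Set (MvPolynomial (Fin n) ℂ) :=
  {P | (∃ Q : MvPolynomial (Fin n) ℂ, IsQuasiSym Q ∧
    P = MvPolynomial.bind₁ (fun i => (X i : MvPolynomial (Fin n) ℂ) ^ m) Q) ∧
    constantCoeff P = 0}

/-- A Dyck vector. -/
def IsDyck {n : ℕ} (η : Fin n → ℕ) : Prop :=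
  ∀ k : Fin n, ∑ i ∈ Finset.univ.filter (· ≤ k), η i ≤ (k : ℕ)

/-- The generating polynomial `Fₙ(t^m) = Σ_{k=0}^{n-1} ((n-k)/(n+k))·C(n+k,k)·t^{mk}`,
over `ℕ`. -/
noncomputable def FnTm (n m : ℕ) : Polynomial ℕ :=
  ∑ k ∈ Finset.range n, Polynomial.C ((n - k) * (n + k).choose k / (n + k)) *
    (Polynomial.X : Polynomial ℕ) ^ (m * k)

/-- `F_{n,m}(t) = (1 + t + ⋯ + t^{m-1})ⁿ · Fₙ(t^m)`. -/
noncomputable def Fnm (n m : ℕ) : Polynomial ℕ :=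
  (∑ j ∈ Finset.range m, (Polynomial.X : Polynomial ℕ) ^ j) ^ n * FnTm n m

/-- Dyck condition on lists with slack `s`. -/
def DyckL : ℕ → List ℕ → Prop
  | _, [] => True
  | s, a :: l => a ≤ s ∧ DyckL (s + 1 - a) l

/-- coefficients of fundamental quasi-symmetric functions -/
def phiF : List ℕ → List ℕ → ℂ
  | [], [] => 1
  | [], _ :: _ => 0
  | v :: ν, [] => if v = 0 then phiF ν [] else 0
  | v :: ν, b :: γ => if v < b then phiF ν ((b - v) :: γ) else if v = b then phiF ν γ else 0

/-- Fundamental quasi-symmetric polynomials -/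
noncomputable def FF : (n : ℕ) → List ℕ → MvPolynomial (Fin n) ℂ
  | _, [] => 1
  | 0, _ :: _ => 0
  | n + 1, b :: γ => (finSuccEquiv ℂ n).symm
      (∑ j ∈ Finset.range b, Polynomial.X ^ j * Polynomial.C (FF n ((b - j) :: γ)) +
        Polynomial.X ^ b * Polynomial.C (FF n γ))

lemma FF_nil (n : ℕ) : FF n [] = 1 := by cases n <;> rfl

lemma fse_FF (n b : ℕ) (γ : List ℕ) : finSuccEquiv ℂ n (FF (n + 1) (b :: γ)) =
    ∑ j ∈ Finset.range b, Polynomial.X ^ j * Polynomial.C (FF n ((b - j) :: γ)) +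
        Polynomial.X ^ b * Polynomial.C (FF n γ) := by
  rw [FF, AlgEquiv.apply_symm_apply]

lemma coeff_FF (n : ℕ) (α : List ℕ) (ν : Fin n →₀ ℕ) :
    MvPolynomial.coeff ν (FF n α) = phiF (List.ofFn fun i => ν i) α := by
  induction n generalizing α with
  | zero =>
    have : ν = 0 := Subsingleton.elim _ _
    subst this
    cases α with
    | nil => simp [FF, phiF]
    | cons b γ => simp [FF, phiF]
  | succ n ih =>
    have hν : ν = Finsupp.cons (ν 0) (Finsupp.tail ν) := (Finsupp.cons_tail ν).symm
    have hl : (List.ofFn fun i => ν i) = ν 0 :: List.ofFn fun i => Finsupp.tail ν i := by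
      rw [List.ofFn_succ]; rfl
    rw [hl]
    conv_lhs => rw [hν]
    rw [← finSuccEquiv_coeff_coeff]
    cases α with
    | nil =>
      rw [FF_nil, map_one, Polynomial.coeff_one, phiF, ← ih, FF_nil]
      split_ifs with h
      · rfl
      · exact MvPolynomial.coeff_zero _
    | cons b γ =>
      rw [fse_FF, phiF, ← ih, ← ih]
      simp only [Polynomial.coeff_add, Polynomial.finsetSum_coeff, Polynomial.coeff_X_pow_mul',
        Polynomial.coeff_C]
      have key : ∀ j, (if j ≤ ν 0 then if ν 0 - j = 0 then FF n ((b - j) :: γ) else 0 else 0)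
          = if j = ν 0 then FF n ((b - j) :: γ) else 0 := by
        intro j
        split_ifs <;> first | rfl | omega
      simp only [key, Finset.sum_ite_eq', Finset.mem_range]
      split_ifs <;> first | omega | simp

lemma phiF_filter (l α : List ℕ) (hα : ∀ a ∈ α, 0 < a) :
    phiF l α = phiF (l.filter (· ≠ 0)) α := by
  induction l generalizing α with
  | nil => rfl
  | cons v ν ih =>
    by_cases hv : v = 0
    · subst hv
      cases α with
      | nil => simp [phiF]; simpa using ih [] (by simp)
      | cons b γ =>
        have : 0 < b := hα b (by simp)
        simp only [phiF, this, if_true, Nat.sub_zero]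
        simpa using ih (b :: γ) hα
    · rw [List.filter_cons_of_pos (by simpa using hv)]
      cases α with
      | nil => simp [phiF, hv]
      | cons b γ =>
        have hγ : ∀ a ∈ γ, 0 < a := fun a ha => hα a (by simp [ha])
        simp only [phiF]
        split_ifs with h1 h2
        · apply ih
          intro a ha
          rcases List.mem_cons.1 ha with h | h
          · omega
          · exact hγ a h
        · exact ih _ hγ
        · rfl

lemma phiF_sum (l α : List ℕ) (h : phiF l α ≠ 0) : l.sum = α.sum := by
  induction l generalizing α with
  | nil =>
    cases α with
    | nil => rfl
    | cons b γ => simp [phiF] at h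
  | cons v ν ih =>
    cases α with
    | nil =>
      simp only [phiF] at h
      split_ifs at h with h1
      · simp [ih _ h, h1]
      · simp at h
    | cons b γ =>
      simp only [phiF] at h
      split_ifs at h with h1 h2
      · have := ih _ h
        simp only [List.sum_cons] at *
        omega
      · have := ih _ h
        simp only [List.sum_cons] at *
        omega
      · simp at h

lemma FF_qsym (n : ℕ) (α : List ℕ) (hα : ∀ a ∈ α, 0 < a) : IsQuasiSym (FF n α) := by
  intro ν μ h
  rw [coeff_FF, coeff_FF, phiF_filter _ _ hα, phiF_filter (List.ofFn fun i => μ i) _ hα]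
  unfold qcomp at h
  rw [h]

lemma FF_homog (n : ℕ) (α : List ℕ) : (FF n α).IsHomogeneous α.sum := by
  intro ν h
  rw [coeff_FF] at h
  rw [← phiF_sum _ _ h, List.sum_ofFn]
  simp [Finsupp.weight_apply, Finsupp.sum_fintype]

/-- auxiliary ideals -/
noncomputable def IC (n c : ℕ) : Ideal (MvPolynomial (Fin n) ℂ) :=
  Ideal.span {P | ∃ α : List ℕ, (∀ a ∈ α, 0 < a) ∧ ¬ DyckL c α ∧ P = FF n α}

lemma FF_mem_IC {n c : ℕ} {α : List ℕ} (h1 : ∀ a ∈ α, 0 < a) (h2 : ¬ DyckL c α) :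
    FF n α ∈ IC n c := Ideal.subset_span ⟨α, h1, h2, rfl⟩

lemma IC_zero_le (n : ℕ) (g : MvPolynomial (Fin n) ℂ) (hg : g ∈ IC n 0) :
    g ∈ Ideal.span {P : MvPolynomial (Fin n) ℂ | IsQuasiSym P ∧ constantCoeff P = 0} := by
  refine Ideal.span_mono ?_ hg
  rintro P ⟨α, h1, h2, rfl⟩
  refine ⟨FF_qsym n α h1, ?_⟩
  rw [constantCoeff_eq]
  by_contra h
  rw [coeff_FF] at h
  have := phiF_sum _ _ h
  rw [List.sum_ofFn] at this
  cases α with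
  | nil => simp [DyckL] at h2
  | cons a l =>
    have := h1 a (by simp)
    simp at *
    omega

lemma lift_zero (n c : ℕ) (g : MvPolynomial (Fin n) ℂ) (hg : g ∈ IC n (c + 1)) :
    (finSuccEquiv ℂ n).symm (Polynomial.C g) ∈ IC (n + 1) c := by
  have : IC n (c + 1) ≤ (IC (n + 1) c).comap
      (((finSuccEquiv ℂ n).symm : _ →+* _).comp Polynomial.C) := by
    unfold IC
    rw [Ideal.span_le]
    rintro P ⟨α, h1, h2, rfl⟩
    simp only [SetLike.mem_coe, Ideal.mem_comap]
    change (finSuccEquiv ℂ n).symm (Polynomial.C (FF n α)) ∈ IC (n + 1) c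
    induction α with
    | nil => simp [DyckL] at h2
    | cons b γ ih =>
      have hb : 0 < b := h1 b (by simp)
      have hγ : ∀ a ∈ γ, 0 < a := fun a ha => h1 a (by simp [ha])
      have hmem : FF (n + 1) (b :: γ) ∈ IC (n + 1) c := by
        apply FF_mem_IC h1
        intro h
        apply h2
        clear * - h
        have mono : ∀ (l : List ℕ) (s : ℕ), DyckL s l → DyckL (s + 1) l := by
          intro l
          induction l with
          | nil => intro s h; trivial
          | cons a l ih =>
            intro s h
            refine ⟨by have := h.1; omega, ?_⟩
            have h1 := h.1
            have := ih _ h.2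
            rwa [show s + 1 + 1 - a = s + 1 - a + 1 by omega]
        exact mono _ _ h
      by_cases hb1 : b = 1
      · subst hb1
        have h3 : ¬ DyckL (c + 1) γ := by
          intro h
          apply h2
          exact ⟨by omega, by simpa using h⟩
        have := ih hγ h3
        have e : (Polynomial.C (FF n (1 :: γ)) : Polynomial (MvPolynomial (Fin n) ℂ)) =
            finSuccEquiv ℂ n (FF (n + 1) (1 :: γ)) - Polynomial.X * Polynomial.C (FF n γ) := by
          rw [fse_FF]; simp
        rw [e, map_sub, AlgEquiv.symm_apply_apply, map_mul]
        exact Ideal.sub_mem _ hmem (Ideal.mul_mem_left _ _ this)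
      · obtain ⟨d, rfl⟩ : ∃ d, b = d + 2 := ⟨b - 2, by omega⟩
        have hmem2 : FF (n + 1) ((d + 1) :: γ) ∈ IC (n + 1) c := by
          apply FF_mem_IC
          · intro a ha
            rcases List.mem_cons.1 ha with h | h
            · omega
            · exact hγ a h
          · intro h
            apply h2
            refine ⟨by have := h.1; omega, ?_⟩
            have := h.2
            rwa [show c + 1 - (d + 1) = c + 1 + 1 - (d + 2) by omega] at this
        have e : (Polynomial.C (FF n ((d + 2) :: γ)) : Polynomial (MvPolynomial (Fin n) ℂ)) =
            finSuccEquiv ℂ n (FF (n + 1) ((d + 2) :: γ)) -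
              Polynomial.X * finSuccEquiv ℂ n (FF (n + 1) ((d + 1) :: γ)) := by
          rw [fse_FF, fse_FF, Finset.sum_range_succ', mul_add, Finset.mul_sum]
          have : ∀ k, d + 2 - (k + 1) = d + 1 - k := by omega
          simp only [this, pow_succ', mul_assoc]
          simp
        rw [e, map_sub, AlgEquiv.symm_apply_apply, map_mul, AlgEquiv.symm_apply_apply]
        exact Ideal.sub_mem _ hmem (Ideal.mul_mem_left _ _ hmem2)
  exact this hg

lemma FF_lead (n b : ℕ) (γ : List ℕ) : ∃ q : Polynomial (MvPolynomial (Fin n) ℂ), q.degree < b ∧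
    Polynomial.X ^ b * Polynomial.C (FF n γ) - q = finSuccEquiv ℂ n (FF (n + 1) (b :: γ)) := by
  refine ⟨-∑ j ∈ Finset.range b, Polynomial.X ^ j * Polynomial.C (FF n ((b - j) :: γ)), ?_, ?_⟩
  · rw [Polynomial.degree_neg]
    refine lt_of_le_of_lt (Polynomial.degree_sum_le _ _) ?_
    rw [Finset.sup_lt_iff (by exact WithBot.bot_lt_coe b)]
    intro j hj
    rw [mul_comm]
    refine lt_of_le_of_lt (Polynomial.degree_C_mul_X_pow_le _ _) ?_
    exact_mod_cast Finset.mem_range.1 hj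
  · rw [fse_FF]; ring

lemma lift_pos (n c a : ℕ) (hac : a ≤ c) (g : MvPolynomial (Fin n) ℂ) (hg : g ∈ IC n (c + 1 - a)) :
    ∃ q : Polynomial (MvPolynomial (Fin n) ℂ), q.degree < a ∧
      (finSuccEquiv ℂ n).symm (Polynomial.X ^ a * Polynomial.C g - q) ∈ IC (n + 1) c := by
  rcases Nat.eq_zero_or_pos a with rfl | ha
  · refine ⟨0, by simp, ?_⟩
    simpa using lift_zero n c g hg
  unfold IC at hg
  induction hg using Submodule.span_induction with
  | mem P hP =>
    obtain ⟨α, h1, h2, rfl⟩ := hP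
    obtain ⟨q, hq, e⟩ := FF_lead n a α
    refine ⟨q, hq, ?_⟩
    rw [e, AlgEquiv.symm_apply_apply]
    apply FF_mem_IC
    · intro x hx
      rcases List.mem_cons.1 hx with h | h
      · omega
      · exact h1 x h
    · intro h
      exact h2 h.2
  | zero => exact ⟨0, by simp, by simp⟩
  | add x y _ _ hx hy =>
    obtain ⟨q1, h1, m1⟩ := hx
    obtain ⟨q2, h2, m2⟩ := hy
    refine ⟨q1 + q2, lt_of_le_of_lt (Polynomial.degree_add_le _ _) (max_lt h1 h2), ?_⟩
    have := Ideal.add_mem _ m1 m2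
    rw [← map_add] at this
    convert this using 2
    rw [map_add]; ring
  | smul r x _ hx =>
    obtain ⟨q1, h1, m1⟩ := hx
    refine ⟨Polynomial.C r * q1, ?_, ?_⟩
    · refine lt_of_le_of_lt (Polynomial.degree_mul_le _ _) ?_
      refine lt_of_le_of_lt (add_le_add_left Polynomial.degree_C_le _) ?_
      simpa using h1
    · have := Ideal.mul_mem_left _ ((finSuccEquiv ℂ n).symm (Polynomial.C r)) m1
      rw [← map_mul] at this
      convert this using 2
      rw [smul_eq_mul, map_mul]; ring

lemma lift_big (n c a : ℕ) (hac : c < a) (g : MvPolynomial (Fin n) ℂ) :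
    ∃ q : Polynomial (MvPolynomial (Fin n) ℂ), q.degree < a ∧
      (finSuccEquiv ℂ n).symm (Polynomial.X ^ a * Polynomial.C g - q) ∈ IC (n + 1) c := by
  obtain ⟨q, hq, e⟩ := FF_lead n a []
  rw [FF_nil, map_one, mul_one] at e
  refine ⟨Polynomial.C g * q, ?_, ?_⟩
  · refine lt_of_le_of_lt (Polynomial.degree_mul_le _ _) ?_
    refine lt_of_le_of_lt (add_le_add_left Polynomial.degree_C_le _) ?_
    simpa using hq
  · have : Polynomial.X ^ a * Polynomial.C g - Polynomial.C g * q =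
      Polynomial.C g * finSuccEquiv ℂ n (FF (n + 1) [a]) := by rw [← e]; ring
    rw [this, map_mul, AlgEquiv.symm_apply_apply]
    apply Ideal.mul_mem_left
    apply FF_mem_IC
    · intro x hx
      simp at hx
      omega
    · intro h
      have := h.1
      omega

lemma fse_symm_monomial (n a : ℕ) (ν : Fin n →₀ ℕ) :
    (finSuccEquiv ℂ n).symm (Polynomial.X ^ a * Polynomial.C (MvPolynomial.monomial ν 1)) =
      MvPolynomial.monomial (Finsupp.cons a ν) 1 := by
  rw [AlgEquiv.symm_apply_eq]
  ext i μ
  rw [finSuccEquiv_coeff_coeff, Polynomial.coeff_X_pow_mul', Polynomial.coeff_C,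
    MvPolynomial.coeff_monomial]
  have : Finsupp.cons a ν = Finsupp.cons i μ ↔ a = i ∧ ν = μ := Finsupp.cons_injective2.eq_iff
  simp only [this]
  by_cases hai : a = i
  · subst hai
    simp [MvPolynomial.coeff_monomial]
  · by_cases h2 : a ≤ i
    · have h3 : i - a ≠ 0 := by omega
      simp [hai, h2, h3]
    · simp [hai, h2]

/-- spanning set -/
noncomputable def SD (n c : ℕ) : Submodule ℂ (MvPolynomial (Fin n) ℂ) :=
  (IC n c).restrictScalars ℂ ⊔
    Submodule.span ℂ {P | ∃ ν : Fin n →₀ ℕ, DyckL c (List.ofFn fun i => ν i) ∧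
      P = MvPolynomial.monomial ν 1}

lemma mem_SD (n c : ℕ) (f : MvPolynomial (Fin n) ℂ) : f ∈ SD n c := by
  induction n generalizing c with
  | zero =>
    rw [MvPolynomial.eq_C_of_isEmpty f]
    apply Submodule.mem_sup_right
    rw [MvPolynomial.C_apply, ← mul_one (MvPolynomial.coeff 0 f), ← smul_eq_mul,
      ← MvPolynomial.smul_monomial]
    apply Submodule.smul_mem
    apply Submodule.subset_span
    exact ⟨0, by simp [DyckL], rfl⟩
  | succ n ih =>
    have main : ∀ (a : ℕ) (p : Polynomial (MvPolynomial (Fin n) ℂ)), p.degree < a →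
        (finSuccEquiv ℂ n).symm p ∈ SD (n + 1) c := by
      intro a
      induction a with
      | zero =>
        intro p hp
        have : p = 0 := by simpa using hp
        rw [this, map_zero]
        exact Submodule.zero_mem _
      | succ a iha =>
        intro p hp
        have red : ∀ g, (∃ q : Polynomial (MvPolynomial (Fin n) ℂ), q.degree < a ∧
          (finSuccEquiv ℂ n).symm (Polynomial.X ^ a * Polynomial.C g - q) ∈ IC (n + 1) c) →
            (finSuccEquiv ℂ n).symm (Polynomial.X ^ a * Polynomial.C g) ∈ SD (n + 1) c := by
          rintro g ⟨q, hq, hm⟩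
          have h1 := iha q hq
          have h2 : (finSuccEquiv ℂ n).symm (Polynomial.X ^ a * Polynomial.C g - q) ∈
            SD (n + 1) c := Submodule.mem_sup_left hm
          have := Submodule.add_mem _ h1 h2
          rw [← map_add] at this
          simpa using this
        have lead : ∀ g, (finSuccEquiv ℂ n).symm (Polynomial.X ^ a * Polynomial.C g) ∈
            SD (n + 1) c := by
          intro g
          rcases lt_or_ge c a with hac | hac
          · exact red g (lift_big n c a hac g)
          · have hg := ih (c + 1 - a) g
            obtain ⟨g1, hg1, g2, hg2, rfl⟩ := Submodule.mem_sup.1 hg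
            rw [map_add, mul_add, map_add]
            refine Submodule.add_mem _ (red g1 (lift_pos n c a hac g1 hg1)) ?_
            clear hg hg1
            induction hg2 using Submodule.span_induction with
            | mem P hP =>
              obtain ⟨ν, hν, rfl⟩ := hP
              rw [fse_symm_monomial]
              apply Submodule.mem_sup_right
              apply Submodule.subset_span
              refine ⟨_, ?_, rfl⟩
              rw [List.ofFn_succ]
              simpa [DyckL, hac] using hν
            | zero => simp
            | add x y _ _ hx hy =>
              rw [map_add, mul_add, map_add]
              exact Submodule.add_mem _ hx hy
            | smul r x _ hx =>
              have : (finSuccEquiv ℂ n).symm (Polynomial.X ^ a * Polynomial.C (r • x)) =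
                r • (finSuccEquiv ℂ n).symm (Polynomial.X ^ a * Polynomial.C x) := by
                rw [← map_smul, ← Polynomial.smul_C, mul_smul_comm]
              rw [this]
              exact Submodule.smul_mem _ _ hx
        have hdeg : (p - Polynomial.X ^ a * Polynomial.C (p.coeff a)).degree < (a : WithBot ℕ) := by
          rw [Polynomial.degree_lt_iff_coeff_zero]
          intro k hk
          rw [Polynomial.coeff_sub, mul_comm, Polynomial.coeff_C_mul_X_pow]
          split_ifs with h
          · rw [h, sub_self]
          · rw [sub_zero]
            apply Polynomial.coeff_eq_zero_of_degree_lt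
            refine lt_of_lt_of_le hp ?_
            exact_mod_cast (by omega : a + 1 ≤ k)
        have := Submodule.add_mem _ (iha _ hdeg) (lead (p.coeff a))
        rw [← map_add] at this
        simpa using this
    have h := main ((finSuccEquiv ℂ n f).natDegree + 1) (finSuccEquiv ℂ n f) (by
      refine lt_of_le_of_lt Polynomial.degree_le_natDegree ?_
      exact_mod_cast Nat.lt_succ_self _)
    simpa using h

/-- ideal generated by quasi-symmetric polynomials without constant term -/
noncomputable def JJ (n : ℕ) : Ideal (MvPolynomial (Fin n) ℂ) :=
  Ideal.span {P : MvPolynomial (Fin n) ℂ | IsQuasiSym P ∧ constantCoeff P = 0}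

/-- set the `i`-th variable to zero -/
noncomputable def KK {n : ℕ} (i : Fin (n + 1)) :
    MvPolynomial (Fin (n + 1)) ℂ →ₐ[ℂ] MvPolynomial (Fin n) ℂ :=
  killCompl (Fin.succAbove_right_injective (p := i))

lemma coeff_KK {n : ℕ} (i : Fin (n + 1)) (f : MvPolynomial (Fin (n + 1)) ℂ) (κ : Fin n →₀ ℕ) :
    MvPolynomial.coeff κ (KK i f) = MvPolynomial.coeff (κ.mapDomain i.succAbove) f :=
  coeff_killCompl _

lemma mapD_self {n : ℕ} (i : Fin (n + 1)) (κ : Fin n →₀ ℕ) : κ.mapDomain i.succAbove i = 0 :=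
  Finsupp.mapDomain_of_notMem_range _ _ (by simp)

lemma mapD_above {n : ℕ} (i : Fin (n + 1)) (κ : Fin n →₀ ℕ) (j : Fin n) :
    κ.mapDomain i.succAbove (i.succAbove j) = κ j :=
  Finsupp.mapDomain_apply Fin.succAbove_right_injective _ _

lemma filter_ofFn {n : ℕ} (i : Fin (n + 1)) (f : Fin (n + 1) → ℕ) (hf : f i = 0) :
    (List.ofFn f).filter (· ≠ 0) = (List.ofFn fun j => f (i.succAbove j)).filter (· ≠ 0) := by
  induction n with
  | zero =>
    have : i = 0 := Fin.ext (by omega)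
    subst this
    simp [hf]
  | succ n ih =>
    cases i using Fin.cases with
    | zero => rw [List.ofFn_succ]; simp [hf]
    | succ i =>
      rw [List.ofFn_succ]
      conv_rhs => rw [List.ofFn_succ]
      have := ih i (fun j => f j.succ) hf
      simp only [Fin.succ_succAbove_zero, Fin.succ_succAbove_succ, List.filter_cons]
      rw [this]

lemma qcomp_mapD {n : ℕ} (i : Fin (n + 1)) (κ : Fin n →₀ ℕ) :
    qcomp (κ.mapDomain i.succAbove) = qcomp κ := by
  unfold qcomp
  rw [filter_ofFn i _ (mapD_self i κ)]
  simp only [mapD_above]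

lemma KK_qsym {n : ℕ} (i : Fin (n + 1)) (f : MvPolynomial (Fin (n + 1)) ℂ) (hf : IsQuasiSym f) :
    IsQuasiSym (KK i f) := by
  intro ν μ h
  rw [coeff_KK, coeff_KK]
  apply hf
  rw [qcomp_mapD, qcomp_mapD, h]

lemma KK_qsym_eq {n : ℕ} (i j : Fin (n + 1)) (f : MvPolynomial (Fin (n + 1)) ℂ)
    (hf : IsQuasiSym f) : KK i f = KK j f := by
  ext κ
  rw [coeff_KK, coeff_KK]
  apply hf
  rw [qcomp_mapD, qcomp_mapD]

lemma KK_JJ {n : ℕ} (i : Fin (n + 1)) (f : MvPolynomial (Fin (n + 1)) ℂ) (hf : f ∈ JJ (n + 1)) :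
    KK i f ∈ JJ n := by
  have : JJ (n + 1) ≤ (JJ n).comap (KK i) := by
    unfold JJ
    rw [Ideal.span_le]
    rintro P ⟨h1, h2⟩
    apply Ideal.subset_span
    refine ⟨KK_qsym i P h1, ?_⟩
    rw [constantCoeff_eq, coeff_KK, Finsupp.mapDomain_zero]
    exact h2
  exact this hf

lemma KK_X_self {n : ℕ} (i : Fin (n + 1)) : KK i (MvPolynomial.X i) = 0 := by
  unfold KK killCompl
  rw [MvPolynomial.aeval_X, dif_neg (by simp)]

lemma KK_X_above {n : ℕ} (i : Fin (n + 1)) (j : Fin n) :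
    KK i (MvPolynomial.X (i.succAbove j)) = MvPolynomial.X j := by
  unfold KK
  rw [← rename_X (R := ℂ) i.succAbove j, killCompl_rename_app]

lemma KK_sub_dvd {n : ℕ} (i : Fin n) (f : MvPolynomial (Fin (n + 1)) ℂ) :
    MvPolynomial.X i ∣ KK i.succ f - KK i.castSucc f := by
  induction f using MvPolynomial.induction_on with
  | C a => simp [KK]
  | add p q hp hq =>
    rw [map_add, map_add, add_sub_add_comm]
    exact dvd_add hp hq
  | mul_X p j hp =>
    have e : KK i.succ (p * MvPolynomial.X j) - KK i.castSucc (p * MvPolynomial.X j) =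
      KK i.succ p * (KK i.succ (MvPolynomial.X j) - KK i.castSucc (MvPolynomial.X j)) +
        (KK i.succ p - KK i.castSucc p) * KK i.castSucc (MvPolynomial.X j) := by
      rw [map_mul, map_mul]; ring
    rw [e]
    refine dvd_add (Dvd.dvd.mul_left ?_ _) (Dvd.dvd.mul_right hp _)
    by_cases hj : j = i.castSucc
    · subst hj
      rw [KK_X_self]
      have := KK_X_above i.succ i
      rw [Fin.succAbove_succ_self] at this
      rw [this, sub_zero]
    · obtain ⟨k, rfl⟩ := Fin.exists_succAbove_eq hj
      rw [KK_X_above]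
      by_cases hk : k = i
      · subst hk
        rw [Fin.succAbove_castSucc_self, KK_X_self, zero_sub]
        exact (dvd_neg).2 dvd_rfl
      · have : i.castSucc.succAbove k = i.succ.succAbove k := by
          rcases lt_or_gt_of_ne hk with h | h
          · rw [Fin.succAbove_of_castSucc_lt _ _ (by simpa using h),
              Fin.succAbove_of_castSucc_lt _ _ (by
                rw [Fin.lt_def] at *; simp; omega)]
          · rw [Fin.succAbove_of_le_castSucc _ _ (by simpa using h.le),
              Fin.succAbove_of_le_castSucc _ _ (by
                rw [Fin.le_def]; rw [Fin.lt_def] at h; simp; omega)]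
        rw [this, KK_X_above, sub_self]
        exact dvd_zero _

lemma exists_trim {n : ℕ} (i : Fin n) (f : MvPolynomial (Fin (n + 1)) ℂ) (hf : f ∈ JJ (n + 1)) :
    ∃ t ∈ JJ n, MvPolynomial.X i * t = KK i.succ f - KK i.castSucc f := by
  have hf' := hf
  unfold JJ at hf
  induction hf using Submodule.span_induction with
  | mem P hP => exact ⟨0, Ideal.zero_mem _, by rw [KK_qsym_eq i.succ i.castSucc P hP.1]; simp⟩
  | zero => exact ⟨0, Ideal.zero_mem _, by simp⟩
  | add x y hx' hy' hx hy =>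
    obtain ⟨t1, h1, e1⟩ := hx hx'
    obtain ⟨t2, h2, e2⟩ := hy hy'
    refine ⟨t1 + t2, Ideal.add_mem _ h1 h2, ?_⟩
    rw [mul_add, e1, e2, map_add, map_add]; ring
  | smul r x hx' hx =>
    obtain ⟨t1, h1, e1⟩ := hx hx'
    obtain ⟨u, hu⟩ := KK_sub_dvd i r
    refine ⟨KK i.succ r * t1 + u * KK i.castSucc x, Ideal.add_mem _ (Ideal.mul_mem_left _ _ h1)
      (Ideal.mul_mem_left _ _ (KK_JJ _ _ hx')), ?_⟩
    rw [smul_eq_mul, map_mul, map_mul, mul_add, ← mul_assoc _ u, ← hu]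
    linear_combination (KK i.succ r) * e1

lemma DyckL_insert {n : ℕ} (i : Fin n) (s : ℕ) (η : Fin (n + 1) → ℕ) (κ : Fin n → ℕ)
    (h0 : η i.castSucc = 0) (h1 : η i.succ = κ i + 1)
    (h2 : ∀ j, j ≠ i → η (i.castSucc.succAbove j) = κ j) (h : DyckL s (List.ofFn η)) :
    DyckL s (List.ofFn κ) := by
  induction n generalizing s with
  | zero => exact i.elim0
  | succ n ih =>
    rw [List.ofFn_succ] at h
    rw [List.ofFn_succ]
    cases i using Fin.cases with
    | zero =>
      rw [List.ofFn_succ] at h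
      obtain ⟨a1, a2, a3⟩ := h
      have e0 : η 0 = 0 := h0
      have e1 : η (Fin.succ 0) = κ 0 + 1 := h1
      have e2 : (fun i : Fin n => η i.succ.succ) = fun i => κ i.succ := by
        funext j
        have := h2 j.succ (Fin.succ_ne_zero j)
        simpa using this
      rw [e0, e1] at a2 a3
      rw [e2] at a3
      refine ⟨by omega, ?_⟩
      rwa [show s + 1 - 0 + 1 - (κ 0 + 1) = s + 1 - κ 0 by omega] at a3
    | succ i =>
      obtain ⟨a1, a2⟩ := h
      have e0 : η 0 = κ 0 := by
        have := h2 0 (Fin.succ_ne_zero i).symm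
        rw [Fin.castSucc_succ, Fin.succ_succAbove_zero] at this
        exact this
      rw [e0] at a1 a2
      refine ⟨a1, ih i _ (fun j => η j.succ) (fun j => κ j.succ) h0 h1 ?_ a2⟩
      intro j hj
      have := h2 j.succ (by simpa using hj)
      rw [Fin.castSucc_succ, Fin.succ_succAbove_succ] at this
      exact this

lemma DyckL_append (s : ℕ) (l l' : List ℕ) (h : DyckL s (l ++ l')) : DyckL s l := by
  induction l generalizing s with
  | nil => trivial
  | cons a l ih => exact ⟨h.1, ih _ h.2⟩

lemma DyckL_castSucc {n : ℕ} (s : ℕ) (η : Fin (n + 1) → ℕ) (h : DyckL s (List.ofFn η)) :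
    DyckL s (List.ofFn fun i => η i.castSucc) := by
  rw [List.ofFn_succ', List.concat_eq_append] at h
  exact DyckL_append _ _ _ h

lemma JJ_zero (f : MvPolynomial (Fin 0) ℂ) (hf : f ∈ JJ 0) : f = 0 := by
  unfold JJ at hf
  have : Ideal.span {P : MvPolynomial (Fin 0) ℂ | IsQuasiSym P ∧ constantCoeff P = 0} ≤ ⊥ := by
    rw [Ideal.span_le]
    rintro P ⟨_, h2⟩
    rw [constantCoeff_eq] at h2
    have := MvPolynomial.eq_C_of_isEmpty P
    rw [h2, map_zero] at this
    exact this
  exact this hf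

lemma exists_mapD {n : ℕ} (i : Fin (n + 1)) (η : Fin (n + 1) →₀ ℕ) (h : η i = 0) :
    ∃ κ : Fin n →₀ ℕ, η = κ.mapDomain i.succAbove := by
  refine ⟨Finsupp.equivFunOnFinite.symm fun j => η (i.succAbove j), ?_⟩
  ext k
  by_cases hk : k = i
  · subst hk; rw [mapD_self, h]
  · obtain ⟨j, rfl⟩ := Fin.exists_succAbove_eq hk
    rw [mapD_above]; rfl

theorem JJ_indep (n : ℕ) (f : MvPolynomial (Fin n) ℂ) (hf : f ∈ JJ n)
    (hd : ∀ ν : Fin n →₀ ℕ, MvPolynomial.coeff ν f ≠ 0 → DyckL 0 (List.ofFn fun i => ν i)) :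
    f = 0 := by
  induction n with
  | zero => exact JJ_zero f hf
  | succ n ih =>
    have step : ∀ i : Fin (n + 1), (∀ j, i < j → ∀ ν : Fin (n + 1) →₀ ℕ, ν j = 0 →
        MvPolynomial.coeff ν f = 0) → ∀ ν : Fin (n + 1) →₀ ℕ, ν i = 0 →
        MvPolynomial.coeff ν f = 0 := by
      intro i hi ν hν
      cases i using Fin.lastCases with
      | last =>
        obtain ⟨κ, rfl⟩ := exists_mapD _ ν hν
        rw [← coeff_KK]
        rw [ih (KK (Fin.last n) f) (KK_JJ _ _ hf), MvPolynomial.coeff_zero]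
        intro μ hμ
        rw [coeff_KK] at hμ
        have := DyckL_castSucc _ _ (hd _ hμ)
        simpa only [← Fin.succAbove_last_apply, mapD_above] using this
      | cast i =>
        by_cases h1 : ν i.succ = 0
        · exact hi i.succ (by simp) ν h1
        obtain ⟨t, ht, e⟩ := exists_trim i f hf
        have hc : ∀ κ, MvPolynomial.coeff κ t = - MvPolynomial.coeff
            ((Finsupp.single i 1 + κ).mapDomain i.castSucc.succAbove) f := by
          intro κ
          have := congrArg (MvPolynomial.coeff (Finsupp.single i 1 + κ)) e
          rw [MvPolynomial.coeff_X_mul, MvPolynomial.coeff_sub, coeff_KK, coeff_KK,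
            hi i.succ (by simp) _ (mapD_self _ _), zero_sub] at this
          exact this
        have ht0 : t = 0 := by
          apply ih t ht
          intro κ hκ
          rw [hc, neg_ne_zero] at hκ
          refine DyckL_insert i 0 _ _ (mapD_self _ _) ?_ ?_ (hd _ hκ)
          · have := mapD_above i.castSucc (Finsupp.single i 1 + κ) i
            rw [Fin.succAbove_castSucc_self] at this
            rw [this]
            simp [add_comm]
          · intro j hj
            rw [mapD_above]
            simp [Ne.symm hj]
        obtain ⟨κ, rfl⟩ := exists_mapD _ ν hν
        have hκ : κ i ≠ 0 := by
          have := mapD_above i.castSucc κ i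
          rw [Fin.succAbove_castSucc_self] at this
          rwa [this] at h1
        have hk : Finsupp.single i 1 + (κ - Finsupp.single i 1) = κ := by
          rw [add_comm]
          apply tsub_add_cancel_of_le
          simpa using Nat.one_le_iff_ne_zero.2 hκ
        have := hc (κ - Finsupp.single i 1)
        rw [hk, ht0, MvPolynomial.coeff_zero] at this
        exact neg_eq_zero.1 this.symm
    have all : ∀ i : Fin (n + 1), ∀ ν : Fin (n + 1) →₀ ℕ, ν i = 0 →
        MvPolynomial.coeff ν f = 0 := by
      intro i
      induction i using WellFoundedGT.induction with
      | ind i h => exact step i h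
    ext ν
    rw [MvPolynomial.coeff_zero]
    by_contra h
    have h1 := hd ν h
    rw [List.ofFn_succ] at h1
    exact h (all 0 ν (Nat.le_zero.1 h1.1))

section Counting

open Classical in
/-- finite set of Dyck vectors -/
noncomputable def DS (n : ℕ) : Finset (Fin n → ℕ) :=
  (Fintype.piFinset fun _ : Fin n => Finset.range n).filter IsDyck

lemma mem_DS {n : ℕ} (η : Fin n → ℕ) : η ∈ DS n ↔ IsDyck η := by
  classical
  simp only [DS, Finset.mem_filter]
  refine ⟨fun h => h.2, fun h => ⟨?_, h⟩⟩
  rw [Fintype.mem_piFinset]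
  intro i
  rw [Finset.mem_range]
  refine lt_of_le_of_lt (le_trans ?_ (h i)) i.2
  exact Finset.single_le_sum (f := η) (fun _ _ => Nat.zero_le _) (by simp)

/-- number of Dyck vectors with given sum -/
noncomputable def cD (n k : ℕ) : ℕ := ((DS n).filter fun η => ∑ i, η i = k).card

/-- number of Dyck vectors with bounded sum -/
noncomputable def cE (n k : ℕ) : ℕ := ((DS n).filter fun η => ∑ i, η i ≤ k).card

lemma isDyck_snoc {n : ℕ} (η : Fin (n + 1) → ℕ) :
    IsDyck η ↔ IsDyck (fun i : Fin n => η i.castSucc) ∧ ∑ i, η i ≤ n := by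
  unfold IsDyck
  rw [Fin.forall_fin_succ']
  have h1 : ∀ k : Fin n, ∑ i ∈ Finset.univ.filter (· ≤ k.castSucc), η i =
      ∑ i ∈ Finset.univ.filter (· ≤ k), η i.castSucc := by
    intro k
    rw [Finset.sum_filter, Finset.sum_filter, Fin.sum_univ_castSucc]
    have : ¬ Fin.last n ≤ k.castSucc := by simp
    simp [this]
  have h2 : (Finset.univ.filter fun i : Fin (n + 1) => i ≤ Fin.last n) = Finset.univ := by
    ext i; simp [Fin.le_last]
  simp only [h1, h2, Fin.val_castSucc, Fin.val_last]

lemma cD_succ (n k : ℕ) (hk : k ≤ n) : cD (n + 1) k = cE n k := by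
  unfold cD cE
  refine Finset.card_bij' (fun η _ => fun i : Fin n => η i.castSucc)
    (fun η _ => Fin.snoc (α := fun _ => ℕ) η (k - ∑ i, η i)) ?_ ?_ ?_ ?_
  · intro η h
    simp only [Finset.mem_filter, mem_DS] at h ⊢
    refine ⟨((isDyck_snoc η).1 h.1).1, ?_⟩
    have := h.2
    rw [Fin.sum_univ_castSucc] at this
    omega
  · intro η h
    simp only [Finset.mem_filter, mem_DS] at h ⊢
    rw [isDyck_snoc, Fin.sum_univ_castSucc]
    simp only [Fin.snoc_castSucc, Fin.snoc_last]
    exact ⟨⟨h.1, by omega⟩, by omega⟩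
  · intro η h
    simp only [Finset.mem_filter, mem_DS] at h
    have := h.2
    rw [Fin.sum_univ_castSucc] at this
    funext j
    cases j using Fin.lastCases with
    | last => simp only [Fin.snoc_last]; omega
    | cast j => simp only [Fin.snoc_castSucc]
  · intro η h
    funext j
    simp only [Fin.snoc_castSucc]

lemma cE_succ (n k : ℕ) : cE n (k + 1) = cE n k + cD n (k + 1) := by
  unfold cD cE
  rw [← Finset.card_union_of_disjoint]
  · congr 1
    ext η
    simp only [Finset.mem_filter, Finset.mem_union, ← and_or_left]
    refine and_congr_right fun _ => ?_
    omega
  · rw [Finset.disjoint_left]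
    intro η h1 h2
    simp only [Finset.mem_filter] at h1 h2
    omega

lemma cD_big (n k : ℕ) (hk : n < k) : cD (n + 1) k = 0 := by
  unfold cD
  rw [Finset.card_eq_zero, Finset.filter_eq_empty_iff]
  intro η h
  rw [mem_DS, isDyck_snoc] at h
  omega

lemma cD_zero (n : ℕ) : cD n 0 = 1 := by
  unfold cD
  rw [Finset.card_eq_one]
  refine ⟨0, ?_⟩
  ext η
  simp only [Finset.mem_filter, mem_DS, Finset.mem_singleton, Finset.sum_eq_zero_iff,
    Finset.mem_univ, true_imp_iff]
  constructor
  · rintro ⟨_, h⟩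
    funext i
    exact h i
  · rintro rfl
    refine ⟨fun k => by simp, fun i => rfl⟩

lemma cD_formula (n j : ℕ) (hj : j ≤ n) :
    cD (n + 1) (j + 1) + (n + j + 1).choose j = (n + j + 1).choose (j + 1) := by
  induction n generalizing j with
  | zero =>
    have : j = 0 := by omega
    subst this
    rw [cD_big _ _ (by omega)]
    simp
  | succ n ih =>
    induction j with
    | zero =>
      rw [cD_succ _ _ (by omega), cE_succ, ← cD_succ _ _ (by omega), cD_zero]
      have := ih 0 (by omega)
      simp at this ⊢
      omega
    | succ j ihj =>
      rcases Nat.lt_or_ge (n) (j + 1) with h | h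
      · have hjn : j = n := by omega
        subst hjn
        rw [cD_big _ _ (by omega), zero_add]
        apply Nat.choose_symm_of_eq_add
        omega
      · rw [cD_succ _ _ (by omega), cE_succ, ← cD_succ _ _ (by omega)]
        have h1 := ih (j + 1) h
        have h2 := ihj (by omega)
        have e1 : n + 1 + (j + 1) + 1 = (n + j + 2) + 1 := by ring
        have e2 : n + (j + 1) + 1 = n + j + 2 := by ring
        have e3 : n + 1 + j + 1 = n + j + 2 := by ring
        have p1 := Nat.choose_succ_succ' (n + j + 2) j
        have p2 := Nat.choose_succ_succ' (n + j + 2) (j + 1)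
        rw [e2] at h1
        rw [e3] at h2
        rw [cD_succ (n + 1) (j + 1) (by omega)] at h2
        rw [e1, p1, p2, cD_succ (n + 1) (j + 1) (by omega)]
        omega

lemma cD_eq (n k : ℕ) (hk : k < n) : (n - k) * (n + k).choose k / (n + k) = cD n k := by
  obtain ⟨N, rfl⟩ : ∃ N, n = N + 1 := ⟨n - 1, by omega⟩
  apply Nat.div_eq_of_eq_mul_right (by omega)
  cases k with
  | zero => simp [cD_zero]
  | succ j =>
    have h1 := cD_formula N j (by omega)
    have h2 := Nat.add_one_mul_choose_eq (N + j + 1) j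
    have h3 := Nat.choose_succ_succ (N + j + 1) j
    simp only [Nat.succ_eq_add_one] at h2 h3
    have e : N + 1 + (j + 1) = N + j + 1 + 1 := by ring
    obtain ⟨d, rfl⟩ : ∃ d, N = j + 1 + d := ⟨N - (j + 1), by omega⟩
    rw [e]
    have e2 : j + 1 + d + 1 - (j + 1) = d + 1 := by omega
    rw [e2]
    generalize cD (j + 1 + d + 1) (j + 1) = D at *
    generalize (j + 1 + d + j + 1 + 1).choose (j + 1) = C0 at *
    generalize (j + 1 + d + j + 1).choose (j + 1) = C1 at *
    generalize (j + 1 + d + j + 1).choose j = C2 at *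
    zify at *
    linear_combination (-(j + 1 + d + j + 1 + 1) : ℤ) * h1 + 2 * h2 + (j + 1 + d + j + 1 + 1 : ℤ) * h3

lemma FnTm_eq (n m : ℕ) (hn : 0 < n) :
    FnTm n m = ∑ η ∈ DS n, (Polynomial.X : Polynomial ℕ) ^ (m * ∑ i, η i) := by
  have hmaps : ∀ η ∈ DS n, ∑ i, η i ∈ Finset.range n := by
    intro η h
    obtain ⟨N, rfl⟩ : ∃ N, n = N + 1 := ⟨n - 1, by omega⟩
    rw [mem_DS, isDyck_snoc] at h
    rw [Finset.mem_range]
    omega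
  rw [← Finset.sum_fiberwise_of_maps_to hmaps]
  unfold FnTm
  refine Finset.sum_congr rfl fun k hk => ?_
  rw [cD_eq n k (Finset.mem_range.1 hk)]
  rw [Finset.sum_congr rfl (g := fun _ => (Polynomial.X : Polynomial ℕ) ^ (m * k))]
  · rw [Finset.sum_const, cD, nsmul_eq_mul]
    simp
  · intro η h
    rw [(Finset.mem_filter.1 h).2]

lemma Fnm_eq (n m : ℕ) (hn : 0 < n) :
    Fnm n m = ∑ p ∈ DS n ×ˢ Fintype.piFinset (fun _ : Fin n => Finset.range m),
      (Polynomial.X : Polynomial ℕ) ^ (∑ i, (m * p.1 i + p.2 i)) := by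
  unfold Fnm
  rw [FnTm_eq n m hn, Finset.sum_product]
  have : (∑ j ∈ Finset.range m, (Polynomial.X : Polynomial ℕ) ^ j) ^ n =
      ∏ _i : Fin n, ∑ j ∈ Finset.range m, (Polynomial.X : Polynomial ℕ) ^ j := by
    simp
  rw [this, Finset.prod_univ_sum, mul_comm, Finset.sum_mul_sum]
  refine Finset.sum_congr rfl fun η _ => Finset.sum_congr rfl fun α _ => ?_
  rw [Finset.prod_pow_eq_pow_sum, ← pow_add, Finset.sum_add_distrib, Finset.mul_sum]

lemma card_pairs (n m d : ℕ) (hn : 0 < n) :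
    Nat.card {p : (Fin n → ℕ) × (Fin n → ℕ) //
          IsDyck p.1 ∧ (∀ i, p.2 i < m) ∧ ∑ i, (m * p.1 i + p.2 i) = d}
        = (Fnm n m).coeff d := by
  rw [Fnm_eq n m hn, Polynomial.finsetSum_coeff]
  simp only [Polynomial.coeff_X_pow]
  rw [Finset.sum_boole, Nat.cast_id]
  apply Nat.subtype_card
  intro p
  simp only [Finset.mem_filter, Finset.mem_product, mem_DS, Fintype.mem_piFinset,
    Finset.mem_range, and_assoc, eq_comm (a := d)]

end Counting

lemma dyck_iff_aux {n : ℕ} (s : ℕ) (η : Fin n → ℕ) : DyckL s (List.ofFn η) ↔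
    ∀ k : Fin n, ∑ i ∈ Finset.univ.filter (· ≤ k), η i ≤ s + (k : ℕ) := by
  induction n generalizing s with
  | zero => simp [DyckL]
  | succ n ih =>
    rw [List.ofFn_succ, DyckL, ih, Fin.forall_fin_succ]
    have h0 : ∑ i ∈ Finset.univ.filter (· ≤ (0 : Fin (n + 1))), η i = η 0 := by
      rw [Finset.sum_filter, Fin.sum_univ_succ]
      simp
    have h1 : ∀ k : Fin n, ∑ i ∈ Finset.univ.filter (· ≤ k.succ), η i =
        η 0 + ∑ i ∈ Finset.univ.filter (· ≤ k), η i.succ := by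
      intro k
      rw [Finset.sum_filter, Finset.sum_filter, Fin.sum_univ_succ]
      simp
    simp only [h0, h1, Fin.val_zero, Fin.val_succ, Nat.add_zero]
    refine and_congr_right fun h => forall_congr' fun k => ?_
    omega

lemma dyck_iff {n : ℕ} (η : Fin n → ℕ) : DyckL 0 (List.ofFn η) ↔ IsDyck η := by
  rw [dyck_iff_aux]
  simp only [Nat.zero_add]
  rfl

lemma IC_homog (n : ℕ) (g : MvPolynomial (Fin n) ℂ) (hg : g ∈ IC n 0) (d : ℕ) :
    homogeneousComponent d g ∈ IC n 0 := by
  letI := MvPolynomial.gradedAlgebra (R := ℂ) (σ := Fin n)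
  refine homogeneousComponent_mem_of_mem ?_ hg d
  apply Ideal.homogeneous_span
  rintro P ⟨α, _, _, rfl⟩
  exact ⟨α.sum, FF_homog n α⟩

lemma hc_monomial {n : ℕ} (d : ℕ) (ν : Fin n →₀ ℕ) :
    homogeneousComponent d (MvPolynomial.monomial ν (1 : ℂ)) =
      if ν.degree = d then MvPolynomial.monomial ν 1 else 0 := by
  ext μ
  rw [coeff_homogeneousComponent]
  by_cases h : ν = μ
  · subst h; split_ifs <;> simp
  · split_ifs <;> simp [h]

lemma reduce_one (n : ℕ) (ν : Fin n →₀ ℕ) : ∃ g ∈ JJ n, ∃ r ∈ Submodule.span ℂ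
    {P : MvPolynomial (Fin n) ℂ | ∃ μ : Fin n →₀ ℕ, DyckL 0 (List.ofFn fun i => μ i) ∧
      μ.degree = ν.degree ∧ P = MvPolynomial.monomial μ 1},
    MvPolynomial.monomial ν 1 = g + r := by
  obtain ⟨g, hg, r, hr, e⟩ := Submodule.mem_sup.1 (mem_SD n 0 (MvPolynomial.monomial ν 1))
  refine ⟨homogeneousComponent ν.degree g, IC_zero_le n _ (IC_homog n g hg _),
    homogeneousComponent ν.degree r, ?_, ?_⟩
  · clear e
    induction hr using Submodule.span_induction with
    | mem P hP =>
      obtain ⟨μ, hμ, rfl⟩ := hP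
      rw [hc_monomial]
      split_ifs with h
      · exact Submodule.subset_span ⟨μ, hμ, h, rfl⟩
      · exact Submodule.zero_mem _
    | zero => rw [map_zero]; exact Submodule.zero_mem _
    | add x y _ _ hx hy => rw [map_add]; exact Submodule.add_mem _ hx hy
    | smul a x _ hx => rw [map_smul]; exact Submodule.smul_mem _ _ hx
  · rw [← map_add, e, hc_monomial, if_pos rfl]

/-- good exponents -/
def Good {n : ℕ} (m : ℕ) (β : Fin n →₀ ℕ) : Prop := IsDyck fun i => β i / m

lemma expand_mem (n m : ℕ) (hm : 0 < m) (g : MvPolynomial (Fin n) ℂ) (hg : g ∈ JJ n) :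
    expand m g ∈ Ideal.span (QInvPlus n m) := by
  have : JJ n ≤ (Ideal.span (QInvPlus n m)).comap (expand m) := by
    unfold JJ
    rw [Ideal.span_le]
    rintro P ⟨h1, h2⟩
    apply Ideal.subset_span
    refine ⟨⟨P, h1, rfl⟩, ?_⟩
    rw [constantCoeff_eq] at *
    rw [coeff_expand_zero m hm.ne']
    exact h2
  exact this hg

lemma exists_divmod {n : ℕ} (m : ℕ) (hm : 0 < m) (β : Fin n →₀ ℕ) :
    ∃ ν α : Fin n →₀ ℕ, β = m • ν + α ∧ ∀ i, α i < m := by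
  refine ⟨Finsupp.equivFunOnFinite.symm fun i => β i / m,
    Finsupp.equivFunOnFinite.symm fun i => β i % m, ?_, fun i => Nat.mod_lt _ hm⟩
  ext i
  simp [Nat.div_add_mod]

lemma good_iff {n : ℕ} (m : ℕ) (ν α : Fin n →₀ ℕ) (hα : ∀ i, α i < m) :
    Good m (m • ν + α) ↔ DyckL 0 (List.ofFn fun i => ν i) := by
  rw [dyck_iff]
  unfold Good
  have : (fun i => (m • ν + α) i / m) = fun i => ν i := by
    funext i
    have := hα i
    simp only [Finsupp.add_apply, Finsupp.smul_apply, smul_eq_mul]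
    rw [Nat.mul_add_div (by omega), Nat.div_eq_of_lt this, Nat.add_zero]
  rw [this]

lemma reduce_m (n m : ℕ) (hm : 0 < m) (β : Fin n →₀ ℕ) :
    ∃ g ∈ Ideal.span (QInvPlus n m), ∃ r ∈ Submodule.span ℂ
    {P : MvPolynomial (Fin n) ℂ | ∃ μ : Fin n →₀ ℕ, Good m μ ∧
      μ.degree = β.degree ∧ P = MvPolynomial.monomial μ 1},
    MvPolynomial.monomial β 1 = g + r := by
  obtain ⟨ν, α, rfl, hα⟩ := exists_divmod m hm β
  obtain ⟨g, hg, r, hr, e⟩ := reduce_one n ν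
  have hmul : ∀ μ : Fin n →₀ ℕ, (MvPolynomial.monomial (m • μ + α) (1 : ℂ)) =
      MvPolynomial.monomial α 1 * expand m (MvPolynomial.monomial μ 1) := by
    intro μ
    have : expand m (MvPolynomial.monomial μ (1 : ℂ)) = MvPolynomial.monomial (m • μ) 1 := by
      rw [MvPolynomial.expand_monomial]
    rw [this, MvPolynomial.monomial_mul, one_mul, add_comm]
  refine ⟨MvPolynomial.monomial α 1 * expand m g, Ideal.mul_mem_left _ _ (expand_mem n m hm g hg),
    MvPolynomial.monomial α 1 * expand m r, ?_, ?_⟩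
  · clear e
    induction hr using Submodule.span_induction with
    | mem P hP =>
      obtain ⟨μ, hμ, h, rfl⟩ := hP
      apply Submodule.subset_span
      refine ⟨m • μ + α, (good_iff m μ α hα).2 hμ, ?_, (hmul μ).symm⟩
      simp [h]
    | zero => simp
    | add x y _ _ hx hy => rw [map_add (expand m), mul_add]; exact Submodule.add_mem _ hx hy
    | smul a x _ hx => rw [map_smul (expand m), mul_smul_comm]; exact Submodule.smul_mem _ _ hx
  · rw [hmul, e, map_add, mul_add]

lemma component (n m : ℕ) (hm : 0 < m) (f : MvPolynomial (Fin n) ℂ)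
    (hf : f ∈ Ideal.span (QInvPlus n m)) (α : Fin n →₀ ℕ) (hα : ∀ i, α i < m)
    (h : MvPolynomial (Fin n) ℂ) :
    ∃ g ∈ JJ n, ∀ ν : Fin n →₀ ℕ, MvPolynomial.coeff ν g =
      MvPolynomial.coeff (m • ν + α) (h * f) := by
  induction hf using Submodule.span_induction generalizing h with
  | mem P hP =>
    obtain ⟨⟨Q, hQ, rfl⟩, hc⟩ := hP
    change constantCoeff (expand m Q) = 0 at hc
    rw [constantCoeff_eq, coeff_expand_zero m hm.ne'] at hc
    have hQJ : Q ∈ JJ n := Ideal.subset_span ⟨hQ, hc⟩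
    change ∃ g ∈ JJ n, ∀ ν : Fin n →₀ ℕ, MvPolynomial.coeff ν g =
      MvPolynomial.coeff (m • ν + α) (h * expand m Q)
    induction h using MvPolynomial.induction_on' with
    | monomial μ a =>
      obtain ⟨η, γ, rfl, hγ⟩ := exists_divmod m hm μ
      by_cases hg : γ = α
      · subst hg
        refine ⟨MvPolynomial.monomial η a * Q, Ideal.mul_mem_left _ _ hQJ, fun ν => ?_⟩
        rw [MvPolynomial.coeff_monomial_mul', MvPolynomial.coeff_monomial_mul']
        have hle : m • η + γ ≤ m • ν + γ ↔ η ≤ ν := by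
          simp only [Finsupp.le_def, Finsupp.add_apply, Finsupp.smul_apply, smul_eq_mul,
            add_le_add_iff_right]
          exact forall_congr' fun i => Nat.mul_le_mul_left_iff hm
        simp only [hle]
        split_ifs with h
        · have : m • ν + γ - (m • η + γ) = m • (ν - η) := by
            ext i
            simp [Nat.mul_sub]
            omega
          rw [this, coeff_expand_smul m hm.ne']
        · rfl
      · refine ⟨0, Ideal.zero_mem _, fun ν => ?_⟩
        rw [MvPolynomial.coeff_zero, MvPolynomial.coeff_monomial_mul']
        split_ifs with hle
        · obtain ⟨i, hi⟩ : ∃ i, γ i ≠ α i := by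
            by_contra hcon
            push Not at hcon
            exact hg (Finsupp.ext hcon)
          rw [coeff_expand_of_not_dvd (i := i), mul_zero]
          have hle := hle i
          rintro ⟨k, hk⟩
          simp only [Finsupp.tsub_apply, Finsupp.add_apply, Finsupp.smul_apply,
            smul_eq_mul] at hle hk
          apply hi
          have e : m * ν i + α i = m * (η i + k) + γ i := by
            rw [mul_add]; omega
          have e2 := congrArg (· % m) e
          simp only [Nat.mul_add_mod, Nat.mod_eq_of_lt (hα i), Nat.mod_eq_of_lt (hγ i)] at e2
          exact e2.symm
        · rfl
    | add p q hp hq =>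
      obtain ⟨g1, h1, e1⟩ := hp
      obtain ⟨g2, h2, e2⟩ := hq
      refine ⟨g1 + g2, Ideal.add_mem _ h1 h2, fun ν => ?_⟩
      rw [MvPolynomial.coeff_add, e1, e2, add_mul, MvPolynomial.coeff_add]
  | zero => exact ⟨0, Ideal.zero_mem _, by simp⟩
  | add x y _ _ hx hy =>
    obtain ⟨g1, h1, e1⟩ := hx h
    obtain ⟨g2, h2, e2⟩ := hy h
    refine ⟨g1 + g2, Ideal.add_mem _ h1 h2, fun ν => ?_⟩
    rw [MvPolynomial.coeff_add, e1, e2, mul_add, MvPolynomial.coeff_add]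
  | smul a x _ hx =>
    obtain ⟨g1, h1, e1⟩ := hx (h * a)
    refine ⟨g1, h1, fun ν => ?_⟩
    rw [e1, smul_eq_mul, mul_assoc]

lemma indep_m (n m : ℕ) (hm : 0 < m) (f : MvPolynomial (Fin n) ℂ)
    (hf : f ∈ Ideal.span (QInvPlus n m))
    (hd : ∀ β : Fin n →₀ ℕ, MvPolynomial.coeff β f ≠ 0 → Good m β) : f = 0 := by
  ext β
  obtain ⟨ν, α, rfl, hα⟩ := exists_divmod m hm β
  obtain ⟨g, hg, e⟩ := component n m hm f hf α hα 1
  simp only [one_mul] at e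
  have hg0 : g = 0 := by
    apply JJ_indep n g hg
    intro μ hμ
    rw [e] at hμ
    exact (good_iff m μ α hα).1 (hd _ hμ)
  rw [← e, hg0, MvPolynomial.coeff_zero, MvPolynomial.coeff_zero]

/-- basis exponents in degree `d` -/
def BT (n m d : ℕ) : Type := {β : Fin n →₀ ℕ // Good m β ∧ β.degree = d}

/-- exponents correspond to pairs -/
noncomputable def BTequiv (n m d : ℕ) (hm : 0 < m) : BT n m d ≃ {p : (Fin n → ℕ) × (Fin n → ℕ) //
    IsDyck p.1 ∧ (∀ i, p.2 i < m) ∧ ∑ i, (m * p.1 i + p.2 i) = d} where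
  toFun β := ⟨(fun i => β.1 i / m, fun i => β.1 i % m), β.2.1, fun i => Nat.mod_lt _ hm, by
    have := β.2.2
    rw [Finsupp.degree_eq_sum] at this
    simpa [Nat.div_add_mod] using this⟩
  invFun p := ⟨Finsupp.equivFunOnFinite.symm fun i => m * p.1.1 i + p.1.2 i, by
    constructor
    · have : (fun i => (m * p.1.1 i + p.1.2 i) / m) = p.1.1 := by
        funext i
        rw [Nat.mul_add_div hm, Nat.div_eq_of_lt (p.2.2.1 i), Nat.add_zero]
      unfold Good
      simp only [Finsupp.coe_equivFunOnFinite_symm]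
      rw [this]
      exact p.2.1
    · rw [Finsupp.degree_eq_sum]
      exact p.2.2.2⟩
  left_inv β := by
    apply Subtype.ext
    ext i
    simp [Nat.div_add_mod]
  right_inv p := by
    apply Subtype.ext
    apply Prod.ext
    · funext i
      simp [Nat.mul_add_div hm, Nat.div_eq_of_lt (p.2.2.1 i)]
    · funext i
      simp [Nat.mul_add_mod, Nat.mod_eq_of_lt (p.2.2.1 i)]

lemma BT_finite (n m d : ℕ) : Finite (BT n m d) := by
  have : {β : Fin n →₀ ℕ | β.degree = d}.Finite := by
    refine (Finset.finite_toSet (Finset.univ.finsuppAntidiag d)).subset ?_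
    intro β hβ
    have hβ : β.degree = d := hβ
    rw [Finsupp.degree_eq_sum] at hβ
    simp [Finset.mem_finsuppAntidiag, hβ]
  have h2 : {β : Fin n →₀ ℕ | Good m β ∧ β.degree = d}.Finite := this.subset fun β h => h.2
  exact h2.to_subtype

lemma finrank_eq (n m d : ℕ) (hm : 0 < m) : Module.finrank ℂ
        (Submodule.map
          (Ideal.Quotient.mkₐ ℂ (Ideal.span (QInvPlus n m))).toLinearMap
          (MvPolynomial.homogeneousSubmodule (Fin n) ℂ d)) = Nat.card (BT n m d) := by
  haveI := BT_finite n m d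
  haveI := Fintype.ofFinite (BT n m d)
  set π := (Ideal.Quotient.mkₐ ℂ (Ideal.span (QInvPlus n m))).toLinearMap with hπ
  have hker : ∀ f, π f = 0 ↔ f ∈ Ideal.span (QInvPlus n m) := by
    intro f
    exact Ideal.Quotient.eq_zero_iff_mem
  let v : BT n m d → MvPolynomial (Fin n) ℂ := fun β => MvPolynomial.monomial β.1 1
  have hv : LinearIndependent ℂ v := by
    have := (MvPolynomial.basisMonomials (Fin n) ℂ).linearIndependent.comp
      (fun β : BT n m d => β.1) Subtype.val_injective
    rw [MvPolynomial.coe_basisMonomials] at this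
    exact this
  have hsupp : ∀ f ∈ Submodule.span ℂ (Set.range v), ∀ β, MvPolynomial.coeff β f ≠ 0 →
      Good m β := by
    intro f hf β
    induction hf using Submodule.span_induction with
    | mem P hP =>
      obtain ⟨γ, rfl⟩ := hP
      intro h
      simp only [v, MvPolynomial.coeff_monomial] at h
      split_ifs at h with h1
      · rw [← h1]; exact γ.2.1
      · exact absurd rfl h
    | zero => simp
    | add x y _ _ hx hy =>
      intro h
      rw [MvPolynomial.coeff_add] at h
      by_cases h1 : MvPolynomial.coeff β x = 0
      · rw [h1, zero_add] at h; exact hy h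
      · exact hx h1
    | smul a x _ hx =>
      intro h
      rw [MvPolynomial.coeff_smul] at h
      exact hx fun h1 => h (by rw [h1, smul_zero])
  have hli : LinearIndependent ℂ (π ∘ v) := by
    apply hv.map
    rw [Submodule.disjoint_def]
    intro f hf1 hf2
    exact indep_m n m hm f ((hker f).1 hf2) (hsupp f hf1)
  have hspan : Submodule.map π (MvPolynomial.homogeneousSubmodule (Fin n) ℂ d) =
      Submodule.span ℂ (Set.range (π ∘ v)) := by
    rw [Set.range_comp, ← Submodule.map_span]
    apply le_antisymm
    · rw [Submodule.map_le_iff_le_comap]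
      intro f hf
      rw [f.as_sum]
      apply Submodule.sum_mem
      intro β hβ
      have hdeg : β.degree = d := by
        have := hf (MvPolynomial.mem_support_iff.1 hβ)
        rw [Finsupp.degree_eq_weight_one]
        exact this
      rw [← mul_one (MvPolynomial.coeff β f), ← smul_eq_mul, ← MvPolynomial.smul_monomial]
      apply Submodule.smul_mem
      obtain ⟨g, hg, r, hr, e⟩ := reduce_m n m hm β
      rw [e, Submodule.mem_comap, map_add, (hker g).2 hg, zero_add]
      apply Submodule.mem_map_of_mem
      refine Submodule.span_mono ?_ hr
      rintro P ⟨μ, h1, h2, rfl⟩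
      exact ⟨⟨μ, h1, h2.trans hdeg⟩, rfl⟩
    · apply Submodule.map_mono
      rw [Submodule.span_le]
      rintro P ⟨β, rfl⟩
      apply MvPolynomial.isHomogeneous_monomial
      exact β.2.2
  rw [hspan, finrank_span_eq_card hli, Nat.card_eq_fintype_card]

/-- the Hilbert series of `ℂ[x₁,…,xₙ]/⟨QInv⁺_{n,m}⟩` is
`F_{n,m}(t) = ((1-t^m)/(1-t))ⁿ · Fₙ(t^m) = (1+t+⋯+t^{m-1})ⁿ · Fₙ(t^m)`:
the dimension of each degree-`d` graded piece of the quotient equals the coefficient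
of `t^d` in `F_{n,m}`, which also counts pairs `(η, α)` with `η` a Dyck vector and
`α ∈ {0,…,m-1}ⁿ` such that `|mη + α| = d`. -/
theorem hilbert_series_super_coinvariants (n m : ℕ) (hn : 0 < n) (hm : 0 < m) :
    (∀ d : ℕ,
      Module.finrank ℂ
        (Submodule.map
          (Ideal.Quotient.mkₐ ℂ (Ideal.span (QInvPlus n m))).toLinearMap
          (MvPolynomial.homogeneousSubmodule (Fin n) ℂ d))
        = (Fnm n m).coeff d) ∧
    ∀ d : ℕ,
      Nat.card {p : (Fin n → ℕ) × (Fin n → ℕ) //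
          IsDyck p.1 ∧ (∀ i, p.2 i < m) ∧ ∑ i, (m * p.1 i + p.2 i) = d}
        = (Fnm n m).coeff d := by

  refine ⟨fun d => ?_, fun d => card_pairs n m d hn⟩
  rw [finrank_eq n m d hm, Nat.card_congr (BTequiv n m d hm), card_pairs n m d hn]
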